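/- Let d = (d_1, ..., d_n) be a decreasing sequence of positive integers with even sum, let a = d_1 be its maximal element and b = d_n its minimal element. If n·b ≥ ⌊(a + b + 1)²/4⌋ − 1 in the case that b is odd or a + b ≡ 1 (mod 4), and n·b ≥ ⌊(a + b + 1)²/4⌋ otherwise, then d is graphic. -/

import Mathlib

/-- A sequence of length `n` is graphic if it is the degree sequence of some
finite simple graph on `n` vertices. -/
def IsGraphic {n : ℕ} (d : Fin n → ℕ) : Prop :=
  ∃ G : SimpleGraph (Fin n), ∀ i, (G.neighborSet i).ncard = d i

/-- The refined Zverovich–Zverovich bound: `n·b ≥ ⌊(a+b+1)²/4⌋ - 1` if `b` is odd or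
`a + b ≡ 1 (mod 4)`, and `n·b ≥ ⌊(a+b+1)²/4⌋` otherwise. -/
def ZZCond (a b n : ℕ) : Prop :=
  if Odd b ∨ (a + b) % 4 = 1 then n * b ≥ (a + b + 1) ^ 2 / 4 - 1
  else n * b ≥ (a + b + 1) ^ 2 / 4

namespace SimpleGraph

variable {V : Type*} [Finite V] {G : SimpleGraph V} {u v : V}

theorem ncard_neighborSet_sup_edge [DecidableEq V] (huv : u ≠ v) (h : ¬ G.Adj u v) (x : V) :
    ((G ⊔ edge u v).neighborSet x).ncard =
      (G.neighborSet x).ncard + (if x = u ∨ x = v then 1 else 0) := by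
  have hvu : ¬ G.Adj v u := fun h' => h h'.symm
  by_cases hxu : x = u
  · subst hxu
    have : (G ⊔ edge x v).neighborSet x = insert v (G.neighborSet x) := by
      ext y; simp only [mem_neighborSet, sup_adj, edge_adj, Set.mem_insert_iff]; grind
    rw [this, Set.ncard_insert_of_notMem (by simpa using h)]; simp
  by_cases hxv : x = v
  · subst hxv
    have : (G ⊔ edge u x).neighborSet x = insert u (G.neighborSet x) := by
      ext y; simp only [mem_neighborSet, sup_adj, edge_adj, Set.mem_insert_iff]; grind
    rw [this, Set.ncard_insert_of_notMem (by simpa using hvu)]; simp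
  · have : (G ⊔ edge u v).neighborSet x = G.neighborSet x := by
      ext y; simp only [mem_neighborSet, sup_adj, edge_adj]; grind
    simp [this, hxu, hxv]

theorem ncard_neighborSet_sdiff_edge [DecidableEq V] (h : G.Adj u v) (x : V) :
    (G.neighborSet x).ncard =
      ((G \ edge u v).neighborSet x).ncard + (if x = u ∨ x = v then 1 else 0) := by
  have hsup : G \ edge u v ⊔ edge u v = G := by
    ext x y; simp only [sup_adj, sdiff_adj, edge_adj]; grind [h.symm, h.ne]
  rw [← ncard_neighborSet_sup_edge h.ne (by simp [edge_adj, h.ne]), hsup]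

theorem exists_adj_not_adj_of_ncard_lt
    (h : (G.neighborSet v).ncard < (G.neighborSet u).ncard) :
    ∃ w, G.Adj u w ∧ ¬ G.Adj v w ∧ w ≠ v := by
  by_contra! hw
  have hsub : G.neighborSet u \ {v} ⊆ G.neighborSet v \ {u} := by
    rintro w ⟨h₁, h₂⟩
    simp only [mem_neighborSet, Set.mem_sdiff, Set.mem_singleton_iff] at *
    grind [h₁.ne]
  have hle := Set.ncard_le_ncard hsub
  by_cases huv : G.Adj u v
  · rw [Set.ncard_sdiff_singleton_of_mem (by simpa using huv),
      Set.ncard_sdiff_singleton_of_mem (by simpa using huv.symm)] at hle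
    have : 0 < (G.neighborSet v).ncard :=
      (Set.ncard_pos).2 ⟨u, by simpa using huv.symm⟩
    omega
  · rw [Set.sdiff_singleton_eq_self (by simpa using huv),
      Set.sdiff_singleton_eq_self (by simpa [adj_comm] using huv)] at hle
    omega

end SimpleGraph

open scoped Classical in
theorem SimpleGraph.ncard_neighborSet_eq_sum {V : Type*} [Fintype V] (G : SimpleGraph V) (x : V) :
    (G.neighborSet x).ncard = ∑ y, if G.Adj x y then 1 else 0 := by
  rw [Finset.sum_boole, Set.ncard_eq_toFinset_card', Nat.cast_id]
  congr 1
  ext y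
  simp

theorem SimpleGraph.even_sum_ncard_neighborSet {V : Type*} [Fintype V] (G : SimpleGraph V) :
    Even (∑ x, (G.neighborSet x).ncard) := by
  classical
  have h : ∀ x, (G.neighborSet x).ncard = G.degree x := fun x => by
    rw [Set.ncard_eq_toFinset_card']; rfl
  simp only [h, G.sum_degrees_eq_twice_card_edges, even_two_mul]

theorem Fin.sum_eq_sum_Iic_add_sum_Ioi {n : ℕ} (f : Fin n → ℕ) (r : Fin n) :
    ∑ i, f i = ∑ i ∈ Finset.Iic r, f i + ∑ i ∈ Finset.Ioi r, f i := by
  rw [← Finset.sum_add_sum_compl (Finset.Iic r) f]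
  congr 2
  ext; simp

/-- `G` has degrees bounded by `d`, with equality before `r`, and the vertices after `r` are
independent. -/
structure IsSubrealization {n : ℕ} (d : Fin n → ℕ) (r : Fin n) (G : SimpleGraph (Fin n)) :
    Prop where
  le (x : Fin n) : (G.neighborSet x).ncard ≤ d x
  eq (x : Fin n) : x < r → (G.neighborSet x).ncard = d x
  indep (x y : Fin n) : r < x → r < y → ¬ G.Adj x y

/-- The Erdős–Gallai inequality at the index `r`. -/
def ErdosGallaiAt {n : ℕ} (d : Fin n → ℕ) (r : Fin n) : Prop :=
  ∑ i ∈ Finset.Iic r, d i ≤ (r + 1) * r + ∑ i ∈ Finset.Ioi r, min (r + 1 : ℕ) (d i)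

namespace IsSubrealization

open SimpleGraph

variable {n : ℕ} {d : Fin n → ℕ} {r : Fin n} {G : SimpleGraph (Fin n)}

theorem improve_of_deficient (hG : IsSubrealization d r G) (hlt : (G.neighborSet r).ncard < d r)
    {k : Fin n} (hk : k ≠ r) (hkd : (G.neighborSet k).ncard < d k) (hkr : ¬ G.Adj r k) :
    ∃ G', IsSubrealization d r G' ∧ (G.neighborSet r).ncard < (G'.neighborSet r).ncard := by
  have h₁ := ncard_neighborSet_sup_edge hk.symm hkr
  have hle := hG.le
  have heq := hG.eq
  have hind := hG.indep
  refine ⟨G ⊔ edge r k, ⟨?_, ?_, ?_⟩, ?_⟩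
  · grind
  · grind
  · simp only [sup_adj, edge_adj]; grind
  · grind

theorem exists_deficient (hG : IsSubrealization d r G) (heven : Even (∑ i, d i))
    (hlt : (G.neighborSet r).ncard + 1 = d r) :
    ∃ k, r < k ∧ (G.neighborSet k).ncard < d k := by
  by_contra! h
  have hE := G.even_sum_ncard_neighborSet
  have heq : ∀ x, x ≠ r → (G.neighborSet x).ncard = d x := by
    intro x hx
    rcases lt_or_gt_of_ne hx with hx | hx
    · exact hG.eq x hx
    · exact le_antisymm (hG.le x) (h x hx)
  rw [← Finset.add_sum_erase _ _ (Finset.mem_univ r)] at hE heven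
  rw [Finset.sum_congr rfl fun x hx => heq x (Finset.ne_of_mem_erase hx)] at hE
  grind

theorem improve_of_not_adj_lt (hG : IsSubrealization d r G) (hd : Antitone d)
    (heven : Even (∑ i, d i)) (hlt : (G.neighborSet r).ncard < d r)
    {i : Fin n} (hi : i < r) (hir : ¬ G.Adj r i) :
    ∃ G', IsSubrealization d r G' ∧ (G.neighborSet r).ncard < (G'.neighborSet r).ncard := by
  have hle := hG.le
  have heq := hG.eq
  have hind := hG.indep
  obtain ⟨u, hiu, hru, hur⟩ := G.exists_adj_not_adj_of_ncard_lt (u := i) (v := r)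
    (by have := hd hi.le; have := heq i hi; omega)
  have hiu' := hiu.ne
  have h₁ := ncard_neighborSet_sdiff_edge hiu
  have h₂ := ncard_neighborSet_sup_edge (G := G \ edge i u) hur.symm (by simp [hru])
  have h₃ := ncard_neighborSet_sup_edge (G := G \ edge i u ⊔ edge r u) hi.ne'
    (by simp only [sup_adj, sdiff_adj, edge_adj]; grind)
  by_cases hdef : (G.neighborSet r).ncard + 1 = d r
  · obtain ⟨k, hk, hkd⟩ := hG.exists_deficient heven hdef
    by_cases hkr : G.Adj r k
    · have h₄ := ncard_neighborSet_sdiff_edge (G := G \ edge i u ⊔ edge r u ⊔ edge r i)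
        (u := r) (v := k) (by simp only [sup_adj, sdiff_adj, edge_adj]; grind)
      refine ⟨(G \ edge i u ⊔ edge r u ⊔ edge r i) \ edge r k, ⟨?_, ?_, ?_⟩, ?_⟩
      · grind
      · grind
      · simp only [sup_adj, sdiff_adj, edge_adj]; grind
      · grind
    · exact hG.improve_of_deficient hlt hk.ne' hkd hkr
  · refine ⟨G \ edge i u ⊔ edge r u ⊔ edge r i, ⟨?_, ?_, ?_⟩, ?_⟩
    · grind
    · grind
    · simp only [sup_adj, sdiff_adj, edge_adj]; grind
    · grind

theorem improve_of_not_adj_gt (hG : IsSubrealization d r G) (hd : Antitone d)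
    (hlt : (G.neighborSet r).ncard < d r) {i k : Fin n} (hi : i < r) (hk : r < k)
    (hkd : (G.neighborSet k).ncard < d k) (hik : ¬ G.Adj i k) :
    ∃ G', IsSubrealization d r G' ∧ (G.neighborSet r).ncard < (G'.neighborSet r).ncard := by
  have hle := hG.le
  have heq := hG.eq
  have hind := hG.indep
  obtain ⟨u, hiu, hru, hur⟩ := G.exists_adj_not_adj_of_ncard_lt (u := i) (v := r)
    (by have := hd hi.le; have := heq i hi; omega)
  have hiu' := hiu.ne
  have h₁ := ncard_neighborSet_sdiff_edge hiu
  have h₂ := ncard_neighborSet_sup_edge (G := G \ edge i u) hur.symm (by simp [hru])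
  have h₃ := ncard_neighborSet_sup_edge (G := G \ edge i u ⊔ edge r u) (hi.trans hk).ne
    (by simp only [sup_adj, sdiff_adj, edge_adj]; grind)
  refine ⟨G \ edge i u ⊔ edge r u ⊔ edge i k, ⟨?_, ?_, ?_⟩, ?_⟩
  · grind
  · grind
  · simp only [sup_adj, sdiff_adj, edge_adj]; grind
  · grind

theorem improve_of_not_adj_lt_lt (hG : IsSubrealization d r G) (hd : Antitone d)
    (hlt : (G.neighborSet r).ncard < d r) (hadj : ∀ i < r, G.Adj r i)
    {i j : Fin n} (hi : i < r) (hj : j < r) (hne : i ≠ j) (hij : ¬ G.Adj i j) :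
    ∃ G', IsSubrealization d r G' ∧ (G.neighborSet r).ncard < (G'.neighborSet r).ncard := by
  have hle := hG.le
  have heq := hG.eq
  have hind := hG.indep
  obtain ⟨u, hiu, hru, hur⟩ := G.exists_adj_not_adj_of_ncard_lt (u := i) (v := r)
    (by have := hd hi.le; have := heq i hi; omega)
  obtain ⟨w, hjw, hrw, hwr⟩ := G.exists_adj_not_adj_of_ncard_lt (u := j) (v := r)
    (by have := hd hj.le; have := heq j hj; omega)
  have hu : r < u := by grind
  have hw : r < w := by grind
  have hiu' := hiu.ne
  have h₁ := ncard_neighborSet_sdiff_edge hiu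
  have hjw' := hjw.ne
  have h₂ := ncard_neighborSet_sdiff_edge (G := G \ edge i u) (u := j) (v := w)
    (by simp only [sdiff_adj, edge_adj]; grind)
  have h₃ := ncard_neighborSet_sup_edge (G := (G \ edge i u) \ edge j w) hur.symm (by simp [hru])
  have h₄ := ncard_neighborSet_sup_edge (G := (G \ edge i u) \ edge j w ⊔ edge r u) hne
    (by simp only [sup_adj, sdiff_adj, edge_adj]; grind)
  refine ⟨(G \ edge i u) \ edge j w ⊔ edge r u ⊔ edge i j, ⟨?_, ?_, ?_⟩, ?_⟩
  · grind
  · grind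
  · simp only [sup_adj, sdiff_adj, edge_adj]; grind
  · grind

theorem not_erdosGallaiAt (hG : IsSubrealization d r G) (hlt : (G.neighborSet r).ncard < d r)
    (hclique : ∀ i ≤ r, ∀ j ≤ r, i ≠ j → G.Adj i j)
    (hmin : ∀ k, r < k → min (r + 1 : ℕ) (d k) ≤ (G.neighborSet k).ncard) :
    ¬ ErdosGallaiAt d r := by
  classical
  have hsum : ∑ i ∈ Finset.Iic r, (G.neighborSet i).ncard =
      (r + 1) * r + ∑ k ∈ Finset.Ioi r, (G.neighborSet k).ncard := by
    simp only [ncard_neighborSet_eq_sum, Fin.sum_eq_sum_Iic_add_sum_Ioi _ r, Finset.sum_add_distrib]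
    congr 1
    · have h : ∀ i ∈ Finset.Iic r,
          (∑ j ∈ Finset.Iic r, if G.Adj i j then 1 else 0) = (r : ℕ) := by
        intro i hi
        rw [Finset.sum_boole]
        have : (Finset.Iic r).filter (G.Adj i) = (Finset.Iic r).erase i := by
          ext j
          simp only [Finset.mem_filter, Finset.mem_Iic, Finset.mem_erase] at *
          grind [G.irrefl]
        rw [this, Finset.card_erase_of_mem hi]
        simp
      rw [Finset.sum_congr rfl h]
      simp
    · rw [Finset.sum_comm, Finset.sum_eq_zero (s := Finset.Ioi r)
        (f := fun i => ∑ j ∈ Finset.Ioi r, if G.Adj i j then 1 else 0), add_zero]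
      · simp only [G.adj_comm]
      · intro i hi
        refine Finset.sum_eq_zero fun j hj => if_neg ?_
        exact hG.indep i j (Finset.mem_Ioi.1 hi) (Finset.mem_Ioi.1 hj)
  have hsumlt : ∑ i ∈ Finset.Iic r, (G.neighborSet i).ncard < ∑ i ∈ Finset.Iic r, d i :=
    Finset.sum_lt_sum (fun i _ => hG.le i) ⟨r, by simp, hlt⟩
  have hsumle := Finset.sum_le_sum fun k (hk : k ∈ Finset.Ioi r) => hmin k (Finset.mem_Ioi.1 hk)
  unfold ErdosGallaiAt
  omega

theorem improve (hG : IsSubrealization d r G) (hd : Antitone d) (heven : Even (∑ i, d i))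
    (hEG : ErdosGallaiAt d r) (hlt : (G.neighborSet r).ncard < d r) :
    ∃ G', IsSubrealization d r G' ∧ (G.neighborSet r).ncard < (G'.neighborSet r).ncard := by
  by_cases hadj : ∀ i < r, G.Adj r i
  swap
  · push Not at hadj
    obtain ⟨i, hi, hir⟩ := hadj
    exact hG.improve_of_not_adj_lt hd heven hlt hi hir
  by_cases hclique : ∀ i < r, ∀ j < r, i ≠ j → G.Adj i j
  swap
  · push Not at hclique
    obtain ⟨i, hi, j, hj, hne, hij⟩ := hclique
    exact hG.improve_of_not_adj_lt_lt hd hlt hadj hi hj hne hij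
  by_contra hno
  refine hG.not_erdosGallaiAt hlt ?_ ?_ hEG
  · intro i hi j hj hne
    rcases hi.lt_or_eq with hi | rfl
    · rcases hj.lt_or_eq with hj | rfl
      · exact hclique i hi j hj hne
      · exact (hadj i hi).symm
    · exact hadj j (lt_of_le_of_ne hj hne.symm)
  · intro k hk
    by_contra! hkd
    rw [lt_min_iff] at hkd
    have hsub : ((Finset.Iic r : Finset (Fin n)) : Set (Fin n)) ⊆ G.neighborSet k := by
      intro i hi
      rw [mem_neighborSet]
      by_contra hki
      rcases (Finset.mem_Iic.1 hi).lt_or_eq with hi | rfl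
      · exact hno (hG.improve_of_not_adj_gt hd hlt hi hk hkd.2 fun h => hki h.symm)
      · exact hno (hG.improve_of_deficient hlt hk.ne' hkd.2 fun h => hki h.symm)
    have := Set.ncard_le_ncard hsub
    rw [Set.ncard_coe_finset, Fin.card_Iic] at this
    omega

theorem exists_eq (hG : IsSubrealization d r G) (hd : Antitone d) (heven : Even (∑ i, d i))
    (hEG : ErdosGallaiAt d r) :
    ∃ G', IsSubrealization d r G' ∧ (G'.neighborSet r).ncard = d r := by
  induction hm : d r - (G.neighborSet r).ncard using Nat.strong_induction_on generalizing G with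
  | _ m ih =>
    rcases (hG.le r).lt_or_eq with hlt | heq
    · obtain ⟨G', hG', hlt'⟩ := hG.improve hd heven hEG hlt
      exact ih _ (by omega) hG' rfl
    · exact ⟨G, hG, heq⟩

end IsSubrealization

/-- The sufficiency half of the Erdős–Gallai theorem. -/
theorem isGraphic_of_erdosGallai {n : ℕ} {d : Fin n → ℕ} (hd : Antitone d)
    (heven : Even (∑ i, d i)) (hEG : ∀ r, ErdosGallaiAt d r) : IsGraphic d := by
  have key : ∀ (k : ℕ) (hk : k < n), ∃ G, IsSubrealization d ⟨k, hk⟩ G ∧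
      (G.neighborSet ⟨k, hk⟩).ncard = d ⟨k, hk⟩ := by
    intro k
    induction k with
    | zero =>
      intro hk
      refine IsSubrealization.exists_eq (G := ⊥) ⟨?_, ?_, ?_⟩ hd heven (hEG _)
      · simp
      · intro x hx; exact absurd hx (by simp [Fin.lt_def])
      · simp
    | succ k ih =>
      intro hk
      obtain ⟨G, hG, heq⟩ := ih (by omega)
      refine IsSubrealization.exists_eq (G := G) ⟨hG.le, ?_, ?_⟩ hd heven (hEG _)
      · intro x hx
        rcases (Nat.lt_succ_iff.1 (Fin.lt_def.1 hx)).lt_or_eq with h | h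
        · exact hG.eq x h
        · rw [show x = ⟨k, by omega⟩ from Fin.ext h]
          exact heq
      · intro x y hx hy
        simp only [Fin.lt_def] at hx hy
        exact hG.indep x y (by rw [Fin.lt_def]; dsimp only; omega)
          (by rw [Fin.lt_def]; dsimp only; omega)
  rcases Nat.eq_zero_or_pos n with rfl | hn
  · exact ⟨⊥, fun i => i.elim0⟩
  · obtain ⟨G, hG, heq⟩ := key (n - 1) (by omega)
    refine ⟨G, fun i => ?_⟩
    rcases (show i.1 ≤ n - 1 by omega).lt_or_eq with h | h
    · exact hG.eq i h
    · rw [show i = ⟨n - 1, by omega⟩ from Fin.ext h]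
      exact heq

theorem ZZCond.le {a b n : ℕ} (h : ZZCond a b n) : (a + b + 1) ^ 2 / 4 - 1 ≤ n * b := by
  unfold ZZCond at h
  split_ifs at h <;> omega

/-- A failure of the Erdős–Gallai inequality for a sequence with values in `[b, a]` whose length
is large compared with `a` and `b` is attained only by a two-valued sequence of odd sum. -/
theorem erdosGallaiAt_of_le {n a b : ℕ} {d : Fin n → ℕ} (hb : 0 < b)
    (hda : ∀ i, d i ≤ a) (hdb : ∀ i, b ≤ d i) (heven : Even (∑ i, d i))
    (hn : (a + b + 1) ^ 2 / 4 - 1 ≤ n * b) (r : Fin n) : ErdosGallaiAt d r := by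
  have h4 : (a + b + 1) ^ 2 < 4 * (n * b + 2) := by omega
  have hr := r.isLt
  have hS₁ : ∑ i ∈ Finset.Iic r, d i ≤ (r + 1) * a := by
    simpa using Finset.sum_le_card_nsmul (Finset.Iic r) d a fun i _ => hda i
  obtain ⟨m, hm⟩ : ∃ m : ℕ, n = r + 1 + m := ⟨n - (r + 1), by omega⟩
  have hcard : (Finset.Ioi r).card = m := by rw [Fin.card_Ioi]; omega
  have hS₂ : m * min (r + 1 : ℕ) b ≤ ∑ i ∈ Finset.Ioi r, min (r + 1 : ℕ) (d i) := by
    simpa [hcard] using Finset.card_nsmul_le_sum (Finset.Ioi r)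
      (fun i => min (r + 1 : ℕ) (d i)) (min (r + 1 : ℕ) b) fun i _ => min_le_min_left _ (hdb i)
  have hab : b ≤ a := (hdb r).trans (hda r)
  by_contra hEG
  unfold ErdosGallaiAt at hEG
  push Not at hEG
  obtain ⟨k, hk⟩ : ∃ k : ℕ, (r : ℕ) = k := ⟨_, rfl⟩
  simp only [hk] at hm hr hS₁ hS₂ hEG
  rcases le_or_gt (k + 1) b with hkb | hkb
  · rw [min_eq_left hkb] at hS₂
    have hna : n ≤ a := by
      have : (k + 1) * (k + m) < (k + 1) * a := by nlinarith
      have := lt_of_mul_lt_mul_left this (Nat.zero_le _)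
      omega
    have hab3 : a + b ≤ 3 := by nlinarith [Nat.mul_le_mul_right b hna, sq_nonneg ((a : ℤ) - b)]
    have hb1 : b = 1 := by omega
    have ha1 : a = 1 := by
      by_contra ha
      have ha2 : a = 2 := by omega
      subst ha2 hb1
      omega
    have hd1 : ∀ i, d i = 1 := fun i => by have := hda i; have := hdb i; omega
    simp only [hd1, Finset.sum_const, Finset.card_univ, Fintype.card_fin, smul_eq_mul,
      mul_one] at heven
    obtain rfl : n = 1 := by omega
    exact absurd heven (by decide)
  · rw [min_eq_right hkb.le] at hS₂
    have hka : 4 * ((k + 1) * a + (k + 1) * b) ≤ (a + b + 1) ^ 2 + 4 * ((k + 1) * k) := by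
      zify
      nlinarith [sq_nonneg ((a : ℤ) + b + 1 - 2 * (k + 1))]
    have hnb : n * b = (k + 1) * b + m * b := by rw [hm]; ring
    have hS₁eq : ∑ i ∈ Finset.Iic r, d i = (k + 1) * a := by omega
    have hS₂eq : ∑ i ∈ Finset.Ioi r, min (k + 1) (d i) = m * b := by omega
    have htight : (k + 1) * a = (k + 1) * k + m * b + 1 := by omega
    have hS₃ : ∑ i ∈ Finset.Ioi r, d i = m * b := by
      have hmin : ∀ i ∈ Finset.Ioi r, b ≤ min (k + 1) (d i) :=
        fun i _ => le_min hkb.le (hdb i)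
      have heq := (Finset.sum_eq_sum_iff_of_le hmin).1 (by simp [hS₂eq, hcard])
      rw [Finset.sum_congr rfl fun i hi => show d i = b by have := heq i hi; omega]
      simp [hcard]
    rw [Fin.sum_eq_sum_Iic_add_sum_Ioi d r, hS₁eq, hS₃, htight] at heven
    have := Nat.even_mul_succ_self k
    grind

/-- A decreasing sequence of positive integers with even sum, maximal element `a` and
minimal element `b`, is graphic if the refined Zverovich–Zverovich bound holds. -/
theorem refined_zverovich_zverovich {n : ℕ} (hn : 0 < n) (d : Fin n → ℕ) (a b : ℕ)
    (ha : a = d ⟨0, hn⟩) (hb : b = d ⟨n - 1, by omega⟩)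
    (hdec : Antitone d) (hpos : ∀ i, 0 < d i) (heven : Even (∑ i, d i))
    (hineq : ZZCond a b n) :
    IsGraphic d := by
  have hda : ∀ i, d i ≤ a := fun i => ha ▸ hdec (Fin.le_def.2 (Nat.zero_le _))
  have hdb : ∀ i, b ≤ d i := fun i => hb ▸ hdec (Fin.le_def.2 (by dsimp only; omega))
  exact isGraphic_of_erdosGallai hdec heven
    (erdosGallaiAt_of_le (hb ▸ hpos _) hda hdb heven hineq.le)
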